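/- (Masuda) Let K be any field and let A₃ = ⟨(x y z cycle)⟩ act on the rational function field K(x,y,z) by cyclically permuting the variables x → y → z → x. Then the fixed field K(x,y,z)^{A₃} equals K(s, u, v), where s = x+y+z, u = (x²y + y²z + z²x − 3xyz)/(x²+y²+z²−xy−yz−zx), and v = (xy² + yz² + zx² − 3xyz)/(x²+y²+z²−xy−yz−zx). In particular K(x,y,z)^{A₃} is purely transcendental over K. -/

import Mathlib

open Polynomial in
/-- An abstract form: the invariants of a field generated by `x, y, z`. -/
theorem masuda_aux {K F : Type*} [Field K] [Field F] [Algebra K F] (σ : F ≃ₐ[K] F)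
    (x y z s u v : F) (hx0 : x ≠ 0) (hxy : x ≠ y) (hyz : y ≠ z) (hxz : x ≠ z)
    (hD : x ^ 2 + y ^ 2 + z ^ 2 - x * y - y * z - z * x ≠ 0)
    (htop : ∀ E : IntermediateField K F, x ∈ E → y ∈ E → z ∈ E → ∀ f, f ∈ E)
    (h1 : σ x = y) (h2 : σ y = z) (h3 : σ z = x)
    (hs : s = x + y + z)
    (hu : u = (x ^ 2 * y + y ^ 2 * z + z ^ 2 * x - 3 * (x * y * z)) /
           (x ^ 2 + y ^ 2 + z ^ 2 - x * y - y * z - z * x))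
    (hv : v = (x * y ^ 2 + y * z ^ 2 + z * x ^ 2 - 3 * (x * y * z)) /
           (x ^ 2 + y ^ 2 + z ^ 2 - x * y - y * z - z * x)) :
    IntermediateField.fixedField (Subgroup.closure {σ}) =
      IntermediateField.adjoin K {s, u, v} := by
  have hfix : ∀ f : F, f ∈ IntermediateField.fixedField (Subgroup.closure {σ}) ↔ σ f = f := by
    intro f
    rw [IntermediateField.mem_fixedField_iff]
    constructor
    · intro h
      exact h σ (Subgroup.subset_closure rfl)
    · intro h g hg
      have : Subgroup.closure {σ} ≤ MulAction.stabilizer (F ≃ₐ[K] F) f := by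
        rw [Subgroup.closure_le]
        rintro _ rfl
        exact h
      exact this hg
  set L := IntermediateField.adjoin K {s, u, v} with hL
  have hsL : s ∈ L := IntermediateField.subset_adjoin _ _ (by simp)
  have huL : u ∈ L := IntermediateField.subset_adjoin _ _ (by simp)
  have hvL : v ∈ L := IntermediateField.subset_adjoin _ _ (by simp)
  have hle : L ≤ IntermediateField.fixedField (Subgroup.closure {σ}) := by
    rw [hL, IntermediateField.adjoin_le_iff]
    intro f hf
    simp only [Set.mem_insert_iff, Set.mem_singleton_iff] at hf
    rw [SetLike.mem_coe, hfix]
    rcases hf with rfl | rfl | rfl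
    · rw [hs]; simp only [map_add, h1, h2, h3]; ring
    · rw [hu]; simp only [map_add, map_sub, map_mul, map_div₀, map_pow, map_ofNat, h1, h2, h3]
      congr 1 <;> ring
    · rw [hv]; simp only [map_add, map_sub, map_mul, map_div₀, map_pow, map_ofNat, h1, h2, h3]
      congr 1 <;> ring
  refine le_antisymm ?_ hle
  have hLσ : ∀ c : L, σ (c : F) = c := fun c => (hfix _).1 (hle c.2)
  have nat3 : (3 : F) ∈ L := ofNat_mem L 3
  have e2 : x * y + y * z + z * x = s * (u + v) - 3 * (u ^ 2 - u * v + v ^ 2) := by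
    rw [hs, hu, hv]
    generalize hd : x ^ 2 + y ^ 2 + z ^ 2 - x * y - y * z - z * x = d at hD ⊢
    field_simp
    rw [← hd]; ring
  have e3 : x * y * z = s * u * v - u ^ 3 - v ^ 3 := by
    rw [hs, hu, hv]
    generalize hd : x ^ 2 + y ^ 2 + z ^ 2 - x * y - y * z - z * x = d at hD ⊢
    field_simp
    rw [← hd]; ring
  have e2L : x * y + y * z + z * x ∈ L := by
    rw [e2]
    exact sub_mem (mul_mem hsL (add_mem huL hvL)) (mul_mem nat3
      (add_mem (sub_mem (pow_mem huL 2) (mul_mem huL hvL)) (pow_mem hvL 2)))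
  have e3L : x * y * z ∈ L := by
    rw [e3]
    exact sub_mem (sub_mem (mul_mem (mul_mem hsL huL) hvL) (pow_mem huL 3)) (pow_mem hvL 3)
  have aE : x ^ 2 * y + y ^ 2 * z + z ^ 2 * x
      = u * (s ^ 2 - 3 * (x * y + y * z + z * x)) + 3 * (x * y * z) := by
    have hd : s ^ 2 - 3 * (x * y + y * z + z * x)
      = x ^ 2 + y ^ 2 + z ^ 2 - x * y - y * z - z * x := by rw [hs]; ring
    rw [hd, hu, div_mul_cancel₀ _ hD]; ring
  have aL : x ^ 2 * y + y ^ 2 * z + z ^ 2 * x ∈ L := by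
    rw [aE]
    exact add_mem (mul_mem huL (sub_mem (pow_mem hsL 2) (mul_mem nat3 e2L))) (mul_mem nat3 e3L)
  -- the cubic
  let P : L[X] := X ^ 3 - C ⟨s, hsL⟩ * X ^ 2 + C ⟨_, e2L⟩ * X - C ⟨_, e3L⟩
  have hPdeg : P.natDegree = 3 := by simp only [P]; compute_degree!
  have hPm : P.Monic := by
    simp only [P]; monicity!
  have hPx : aeval x P = 0 := by
    simp only [P, map_add, map_sub, map_mul, map_pow, aeval_X, aeval_C]
    simp only [IntermediateField.algebraMap_apply, hs]
    ring
  have hint : IsIntegral L x := ⟨P, hPm, hPx⟩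
  -- everything lies in `L(x)`
  let M : IntermediateField L F := IntermediateField.adjoin L {x}
  have hLM : ∀ f ∈ L, f ∈ M := fun f hf => M.algebraMap_mem ⟨f, hf⟩
  have hxM : x ∈ M := IntermediateField.mem_adjoin_simple_self L x
  have hyzM : y * z ∈ M := by
    have : y * z = x * y * z / x := by field_simp
    rw [this]; exact div_mem (hLM _ e3L) hxM
  have hyM : y ∈ M := by
    have hne : x ^ 2 + y * z - x * (s - x) ≠ 0 := by
      have : x ^ 2 + y * z - x * (s - x) = (x - y) * (x - z) := by rw [hs]; ring
      rw [this]; exact mul_ne_zero (sub_ne_zero.2 hxy) (sub_ne_zero.2 hxz)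
    have : y = (x ^ 2 * y + y ^ 2 * z + z ^ 2 * x - x * ((s - x) * (s - x) - y * z)) /
        (x ^ 2 + y * z - x * (s - x)) := by
      rw [eq_div_iff hne, hs]; ring
    have hsx : s - x ∈ M := sub_mem (hLM _ hsL) hxM
    rw [this]
    exact div_mem (sub_mem (hLM _ aL) (mul_mem hxM (sub_mem (mul_mem hsx hsx) hyzM)))
      (sub_mem (add_mem (pow_mem hxM 2) hyzM) (mul_mem hxM hsx))
  have hzM : z ∈ M := by
    have : z = s - x - y := by rw [hs]; ring
    rw [this]; exact sub_mem (sub_mem (hLM _ hsL) hxM) hyM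
  have hall : ∀ f, f ∈ M := fun f => htop (M.restrictScalars K) hxM hyM hzM f
  intro f hf
  rw [hfix] at hf
  have hfa : f ∈ Algebra.adjoin L {x} := by
    rw [← IntermediateField.adjoin_simple_toSubalgebra_of_isAlgebraic hint.isAlgebraic]
    exact hall f
  rw [Algebra.adjoin_singleton_eq_range_aeval] at hfa
  obtain ⟨p, hp⟩ := hfa
  have hp' : aeval x (p %ₘ P) = f := by
    rw [← hp]
    conv_rhs => rw [← modByMonic_add_div p P]
    simp [hPx]
  have hdeg : (p %ₘ P).natDegree < 3 := by
    rw [← hPdeg]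
    exact natDegree_modByMonic_lt p hPm (by intro h; rw [h] at hPdeg; simp at hPdeg)
  rw [aeval_eq_sum_range' hdeg] at hp'
  simp only [Finset.sum_range_succ, Finset.sum_range_zero, zero_add, pow_zero, pow_one,
    Algebra.smul_def, IntermediateField.algebraMap_apply, mul_one] at hp'
  generalize (p %ₘ P).coeff 0 = a at hp'
  generalize (p %ₘ P).coeff 1 = b at hp'
  generalize (p %ₘ P).coeff 2 = c at hp'
  have hq : (a : F) + b * y + c * y ^ 2 = f := by
    have := congrArg σ hp'
    simpa only [map_add, map_mul, map_pow, hLσ, h1, hf] using this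
  have hr : (a : F) + b * z + c * z ^ 2 = f := by
    have := congrArg σ hq
    simpa only [map_add, map_mul, map_pow, hLσ, h2, hf] using this
  have t1 : (b : F) + c * (x + y) = 0 := by
    apply mul_left_cancel₀ (sub_ne_zero.2 hxy)
    linear_combination hp' - hq
  have t2 : (b : F) + c * (y + z) = 0 := by
    apply mul_left_cancel₀ (sub_ne_zero.2 hyz)
    linear_combination hq - hr
  have t3 : (c : F) = 0 := by
    apply mul_left_cancel₀ (sub_ne_zero.2 hxz)
    linear_combination t1 - t2
  have t4 : (b : F) = 0 := by
    rw [t3] at t1; simpa using t1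
  rw [← hp', t3, t4]
  simp

/-- Masuda's theorem: the fixed field of the cyclic permutation action of `A₃`
on `K(x,y,z)` is `K(x+y+z, u, v)`. -/
theorem masuda_A3_invariants (K : Type*) [Field K] :
    ∀ (σ : FractionRing (MvPolynomial (Fin 3) K) ≃ₐ[K] FractionRing (MvPolynomial (Fin 3) K)),
    letI R := MvPolynomial (Fin 3) K
    letI F := FractionRing R
    letI x : F := algebraMap R F (MvPolynomial.X 0)
    letI y : F := algebraMap R F (MvPolynomial.X 1)
    letI z : F := algebraMap R F (MvPolynomial.X 2)
    σ x = y → σ y = z → σ z = x →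
    IntermediateField.fixedField (Subgroup.closure {σ}) =
      IntermediateField.adjoin K
        {x + y + z,
         (x ^ 2 * y + y ^ 2 * z + z ^ 2 * x - 3 * (x * y * z)) /
           (x ^ 2 + y ^ 2 + z ^ 2 - x * y - y * z - z * x),
         (x * y ^ 2 + y * z ^ 2 + z * x ^ 2 - 3 * (x * y * z)) /
           (x ^ 2 + y ^ 2 + z ^ 2 - x * y - y * z - z * x)} := by
  intro σ h1 h2 h3
  have hinj : Function.Injective (algebraMap (MvPolynomial (Fin 3) K)
    (FractionRing (MvPolynomial (Fin 3) K))) := IsFractionRing.injective _ _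
  refine masuda_aux σ _ _ _ _ _ _ ?_ ?_ ?_ ?_ ?_ ?_ h1 h2 h3 rfl rfl rfl
  · exact (map_ne_zero_iff _ hinj).2 (MvPolynomial.X_ne_zero 0)
  · exact fun h => absurd (MvPolynomial.X_injective (hinj h)) (by decide)
  · exact fun h => absurd (MvPolynomial.X_injective (hinj h)) (by decide)
  · exact fun h => absurd (MvPolynomial.X_injective (hinj h)) (by decide)
  · intro h
    simp only [← map_pow, ← map_mul, ← map_add, ← map_sub] at h
    rw [map_eq_zero_iff _ hinj] at h
    have := congrArg (MvPolynomial.eval (fun i : Fin 3 => if i = 0 then (1 : K) else 0)) h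
    simp at this
  · intro E hx hy hz f
    have hR : ∀ q : MvPolynomial (Fin 3) K, algebraMap (MvPolynomial (Fin 3) K)
        (FractionRing (MvPolynomial (Fin 3) K)) q ∈ E := by
      intro q
      induction q using MvPolynomial.induction_on with
      | C a =>
        rw [← MvPolynomial.algebraMap_eq, ← IsScalarTower.algebraMap_apply]
        exact E.algebraMap_mem a
      | add p q hp hq => rw [map_add]; exact add_mem hp hq
      | mul_X p i hp =>
        rw [map_mul]
        refine mul_mem hp ?_
        fin_cases i
        · exact hx
        · exact hy
        · exact hz
    obtain ⟨p, q, _, rfl⟩ := IsFractionRing.div_surjective (A := MvPolynomial (Fin 3) K) f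
    exact div_mem (hR p) (hR q)
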